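/- Let n ≥ 4 and let j, k be nonzero integers. The subgroup of B_n generated by σ_1^j and σ_2^k is a free group of rank 2 if and only if the set {|j|, |k|} is not one of {1}, {1,2}, {1,3}. -/

import Mathlib

/-- Relators for the braid group with generators `σ_0, …, σ_{m-1}`:
the braid relations `σ_i σ_j σ_i = σ_j σ_i σ_j` for `j = i+1`, and the
commutation relations `σ_i σ_j = σ_j σ_i` for `j ≥ i+2`. -/
def braidRels (m : ℕ) : Set (FreeGroup (Fin m)) :=
  { r | ∃ i j : Fin m,
      ((i : ℕ) + 1 = (j : ℕ) ∧
        r = FreeGroup.of i * FreeGroup.of j * FreeGroup.of i *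
            (FreeGroup.of j * FreeGroup.of i * FreeGroup.of j)⁻¹) ∨
      ((i : ℕ) + 2 ≤ (j : ℕ) ∧
        r = FreeGroup.of i * FreeGroup.of j * (FreeGroup.of j * FreeGroup.of i)⁻¹) }

/-- The braid group on `n` strands: the presented group with generators
`σ_1, …, σ_{n-1}` (indexed by `Fin (n-1)`) and the braid relators. -/
abbrev BraidGroup (n : ℕ) : Type := PresentedGroup (braidRels (n - 1))

/-- The standard generator `σ_{i+1}` of the braid group (0-indexed). -/
def braidσ (n : ℕ) (i : Fin (n - 1)) : BraidGroup n := PresentedGroup.of i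

/-- The element `δ = σ_1 σ_2 ⋯ σ_{n-1}` of the braid group. -/
def braidδ (n : ℕ) : BraidGroup n := (List.ofFn (braidσ n)).prod

/-- The full twist `z = (σ_1 σ_2 ⋯ σ_{n-1})^n`. -/
def fullTwist (n : ℕ) : BraidGroup n := braidδ n ^ n

/-- A ping-pong criterion for freeness in which all nonzero powers of a generator play together. -/
theorem FreeGroup.lift_injective_of_zpow_ping_pong {ι G α : Type*} [Nontrivial ι] [Group G]
    [MulAction G α] (a : ι → G) (X : ι → Set α) (hX : ∀ i, (X i).Nonempty)
    (hdisj : Pairwise fun i j => Disjoint (X i) (X j))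
    (hpp : Pairwise fun i j => ∀ m : ℤ, m ≠ 0 → ∀ x ∈ X j, a i ^ m • x ∈ X i) :
    Function.Injective (FreeGroup.lift a) := by
  have hlift : FreeGroup.lift a =
      (Monoid.CoprodI.lift fun i => FreeGroup.lift fun _ : Unit => a i).comp
        (freeGroupEquivCoprodI (ι := ι)).toMonoidHom := by
    ext i
    simp
  rw [hlift, MonoidHom.coe_comp]
  refine Function.Injective.comp ?_ freeGroupEquivCoprodI.injective
  refine Monoid.CoprodI.lift_injective_of_ping_pong _ ?_ X hX hdisj ?_
  · obtain ⟨i, -⟩ := exists_pair_ne ι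
    exact Or.inr ⟨i, (Cardinal.ofNat_lt_aleph0 (n := 3)).le.trans (Cardinal.aleph0_le_mk _)⟩
  · rintro i j hij h hh _ ⟨x, hx, rfl⟩
    obtain ⟨m, rfl⟩ := FreeGroup.freeGroupUnitEquivInt.symm.surjective h
    have hm : m ≠ 0 := by
      rintro rfl
      exact hh (zpow_zero _)
    simpa [FreeGroup.freeGroupUnitEquivInt] using hpp hij m hm x hx

/-- A free group on at least two generators has trivial center. -/
theorem FreeGroup.eq_one_of_forall_commute {α : Type*} [Nontrivial α] {x : FreeGroup α}
    (hx : ∀ y, Commute x y) : x = 1 := by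
  classical
  by_contra hne
  obtain ⟨⟨a, s⟩, L, hw⟩ := List.exists_cons_of_ne_nil (mt FreeGroup.toWord_eq_nil_iff.mp hne)
  obtain ⟨b, hb⟩ := exists_ne a
  have hred : FreeGroup.reduce ((a, s) :: L) = (a, s) :: L := by
    rw [← hw, FreeGroup.reduce_toWord]
  have hleft : (FreeGroup.of b * x).toWord = (b, true) :: (a, s) :: L := by
    rw [FreeGroup.toWord_mul, FreeGroup.toWord_of, hw, List.singleton_append,
      FreeGroup.reduce.cons, hred]
    simp [hb]
  have hsub := FreeGroup.toWord_mul_sublist x (FreeGroup.of b)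
  rw [(hx _).eq, hleft, hw, FreeGroup.toWord_of] at hsub
  have heq := hsub.eq_of_length (by simp)
  simp [hb] at heq

/-- A subgroup containing a nontrivial element that commutes with its generators is not free
of rank two. -/
theorem not_nonempty_closure_equiv_freeGroup {G : Type*} [Group G] {a b z : G}
    (hz : z ∈ Subgroup.closure {a, b}) (hne : z ≠ 1) (ha : Commute z a) (hb : Commute z b) :
    ¬ Nonempty (Subgroup.closure {a, b} ≃* FreeGroup (Fin 2)) := by
  rintro ⟨e⟩
  have hcent : Subgroup.closure {a, b} ≤ Subgroup.centralizer {z} := by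
    rw [Subgroup.closure_le]
    rintro x (rfl | rfl) <;> simp [Subgroup.mem_centralizer_iff, ha.eq, hb.eq]
  have hone : e ⟨z, hz⟩ = 1 := by
    refine FreeGroup.eq_one_of_forall_commute fun y => ?_
    obtain ⟨⟨w, hw⟩, rfl⟩ := e.surjective y
    refine Commute.map (Subtype.ext ?_) e
    exact Subgroup.mem_centralizer_iff.mp (hcent hw) z rfl
  exact hne (congrArg Subtype.val ((map_eq_one_iff e e.injective).mp hone))

section BraidRelation

variable {G : Type*} [Group G] {a b : G}

theorem braid_mul_left (h : a * b * a = b * a * b) : a * (a * b * a) = a * b * a * b := by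
  nth_rw 1 [h]
  simp only [mul_assoc]

theorem braid_mul_right (h : a * b * a = b * a * b) : b * (a * b * a) = a * b * a * a := by
  nth_rw 2 [h]
  simp only [mul_assoc]

theorem commute_braid_sq_left (h : a * b * a = b * a * b) : Commute ((a * b * a) ^ 2) a := by
  rw [commute_iff_eq, sq, mul_assoc, ← braid_mul_right h, ← mul_assoc, ← braid_mul_left h,
    mul_assoc]

theorem commute_braid_sq_right (h : a * b * a = b * a * b) : Commute ((a * b * a) ^ 2) b := by
  rw [commute_iff_eq, sq, mul_assoc, ← braid_mul_left h, ← mul_assoc, ← braid_mul_right h,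
    mul_assoc]

theorem mul_sq_sq_eq (h : a * b * a = b * a * b) : (a * b ^ 2) ^ 2 = (a * b * a) ^ 2 := by
  calc (a * b ^ 2) ^ 2 = a * b * (b * a * b) * b := by simp only [sq, mul_assoc]
    _ = a * b * (a * b * a) * b := by rw [h]
    _ = a * b * a * (b * a * b) := by simp only [mul_assoc]
    _ = (a * b * a) ^ 2 := by rw [← h, sq]

theorem mul_cube_cube_eq (h : a * b * a = b * a * b) :
    (a * b ^ 3) ^ 3 = (a * b * a) ^ 4 := by
  calc (a * b ^ 3) ^ 3 = a * b * b * (b * a * b) * b * (b * a * b) * b * b := by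
        simp only [pow_succ, pow_zero, one_mul, mul_assoc]
    _ = a * b ^ 2 * ((a * b * a) * (b * (a * b * a))) * b ^ 2 := by
        rw [← h]; simp only [sq, mul_assoc]
    _ = a * b ^ 2 * ((a * b * a) ^ 2 * (a * b ^ 2)) := by
        rw [braid_mul_right h]; simp only [sq, mul_assoc]
    _ = (a * b * a) ^ 2 * (a * b ^ 2) ^ 2 := by
        have hc : Commute ((a * b * a) ^ 2) (a * b ^ 2) :=
          (commute_braid_sq_left h).mul_right ((commute_braid_sq_right h).pow_right 2)
        rw [← mul_assoc, ← hc.eq, mul_assoc, ← sq]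
    _ = (a * b * a) ^ 4 := by rw [mul_sq_sq_eq h, ← pow_add]

theorem braid_pow_four_mem_closure (h : a * b * a = b * a * b) {j k : ℤ} (hj : |j| = 1)
    (hk : |k| = 1 ∨ |k| = 2 ∨ |k| = 3) :
    (a * b * a) ^ 4 ∈ Subgroup.closure {a ^ j, b ^ k} := by
  set H := Subgroup.closure {a ^ j, b ^ k}
  have haj : a ^ j ∈ H := Subgroup.subset_closure (by simp)
  have hbk : b ^ k ∈ H := Subgroup.subset_closure (by simp)
  have ha : a ∈ H := by
    rcases abs_eq (zero_le_one' ℤ) |>.mp hj with rfl | rfl <;> simpa using haj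
  have hb : b ^ |k| ∈ H := by
    rcases abs_choice k with hk' | hk' <;> rw [hk']
    · exact hbk
    · simpa using hbk
  rcases hk with hk | hk | hk <;> rw [hk] at hb
  · rw [zpow_one] at hb
    exact pow_mem (mul_mem (mul_mem ha hb) ha) 4
  · rw [show (a * b * a) ^ 4 = ((a * b ^ (2 : ℤ)) ^ 2) ^ 2 by
      rw [zpow_ofNat, mul_sq_sq_eq h, ← pow_mul]]
    exact pow_mem (pow_mem (mul_mem ha hb) 2) 2
  · rw [← mul_cube_cube_eq h, ← zpow_ofNat b 3]
    exact pow_mem (mul_mem ha hb) 3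

theorem not_free_of_braid_relation (h : a * b * a = b * a * b) (hne : (a * b * a) ^ 4 ≠ 1)
    {j k : ℤ} (hj : |j| = 1) (hk : |k| = 1 ∨ |k| = 2 ∨ |k| = 3) :
    ¬ Nonempty (Subgroup.closure {a ^ j, b ^ k} ≃* FreeGroup (Fin 2)) := by
  have hsq : (a * b * a) ^ 4 = ((a * b * a) ^ 2) ^ 2 := by rw [← pow_mul]
  refine not_nonempty_closure_equiv_freeGroup (braid_pow_four_mem_closure h hj hk) hne ?_ ?_
  · rw [hsq]; exact ((commute_braid_sq_left h).pow_left 2).zpow_right j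
  · rw [hsq]; exact ((commute_braid_sq_right h).pow_left 2).zpow_right k

end BraidRelation

section BraidGroup

theorem PresentedGroup.braid_relation {m : ℕ} {i j : Fin m} (hij : (i : ℕ) + 1 = j) :
    (of i * of j * of i : PresentedGroup (braidRels m)) = of j * of i * of j := by
  have hr := one_of_mem (rels := braidRels m) ⟨i, j, Or.inl ⟨hij, rfl⟩⟩
  rw [map_mul, map_inv, mul_inv_eq_one] at hr
  exact hr

/-- A family of group elements indexed by `ℕ` that satisfies the braid and the commutation
relations gives a homomorphism from the braid group. -/
def BraidGroup.lift {G : Type*} [Group G] (s : ℕ → G)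
    (hbraid : ∀ i, s i * s (i + 1) * s i = s (i + 1) * s i * s (i + 1))
    (hcomm : ∀ i j, i + 2 ≤ j → s i * s j = s j * s i) (n : ℕ) : BraidGroup n →* G :=
  PresentedGroup.toGroup (f := fun i : Fin (n - 1) => s i) <| by
    rintro _ ⟨i, j, ⟨hij, rfl⟩ | ⟨hij, rfl⟩⟩
    · simp [← hij, hbraid, ← mul_assoc]
    · simp [hcomm _ _ hij, ← mul_assoc]

theorem BraidGroup.lift_braidσ {G : Type*} [Group G] (s : ℕ → G)
    (hbraid : ∀ i, s i * s (i + 1) * s i = s (i + 1) * s i * s (i + 1))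
    (hcomm : ∀ i j, i + 2 ≤ j → s i * s j = s j * s i) (n : ℕ) (i : Fin (n - 1)) :
    BraidGroup.lift s hbraid hcomm n (braidσ n i) = s i :=
  PresentedGroup.toGroup.of _

/-- The exponent sum on the braid group. -/
def exponentSum (n : ℕ) : BraidGroup n →* Multiplicative ℤ :=
  BraidGroup.lift (fun _ => Multiplicative.ofAdd 1) (fun _ => rfl) (fun _ _ _ => rfl) n

theorem braid_pow_four_ne_one {n : ℕ} (i j : Fin (n - 1)) :
    (braidσ n i * braidσ n j * braidσ n i) ^ 4 ≠ 1 := by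
  intro h
  have h' := congrArg (exponentSum n) h
  simp only [exponentSum, map_pow, map_mul, BraidGroup.lift_braidσ, map_one] at h'
  exact absurd h' (by decide)

/-- The transvection adding `m` times the `i`-th coordinate to the coordinate after it and
subtracting it from the coordinate before it. -/
def braidTransvection (i : ℕ) (m : ℤ) (v : ℕ → ℤ) : ℕ → ℤ := fun l =>
  if l = i + 1 then v l + m * v i else if l + 1 = i then v l - m * v i else v l

theorem braidTransvection_add (i : ℕ) (m m' : ℤ) (v : ℕ → ℤ) :
    braidTransvection i m (braidTransvection i m' v) = braidTransvection i (m + m') v := by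
  funext l
  simp only [braidTransvection]
  grind

theorem braidTransvection_zero (i : ℕ) (v : ℕ → ℤ) : braidTransvection i 0 v = v := by
  funext l
  simp [braidTransvection]

/-- The powers of a transvection, as a homomorphism. -/
def braidTransvectionHom (i : ℕ) : Multiplicative ℤ →* Equiv.Perm (ℕ → ℤ) :=
  MonoidHom.toHomPerm
    { toFun := fun m => braidTransvection i m.toAdd
      map_one' := funext (braidTransvection_zero i)
      map_mul' := fun m m' => funext fun v => (braidTransvection_add i m.toAdd m'.toAdd v).symm }

/-- The transvection representation of the braid group: the reduced Burau representation
at `-1`, in the limit over all numbers of strands. -/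
def braidTransvectionRep (n : ℕ) : BraidGroup n →* Equiv.Perm (ℕ → ℤ) :=
  BraidGroup.lift (fun i => braidTransvectionHom i (Multiplicative.ofAdd 1))
    (fun i => by
      ext v l
      change braidTransvection _ 1 (braidTransvection _ 1 (braidTransvection _ 1 v)) l =
        braidTransvection _ 1 (braidTransvection _ 1 (braidTransvection _ 1 v)) l
      simp only [braidTransvection]
      grind)
    (fun i j hij => by
      ext v l
      change braidTransvection _ 1 (braidTransvection _ 1 v) l =
        braidTransvection _ 1 (braidTransvection _ 1 v) l
      simp only [braidTransvection]
      grind) n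

theorem braidTransvectionRep_zpow (n : ℕ) (i : Fin (n - 1)) (m : ℤ) (v : ℕ → ℤ) :
    braidTransvectionRep n (braidσ n i ^ m) v = braidTransvection i m v := by
  rw [map_zpow, braidTransvectionRep, BraidGroup.lift_braidσ, ← map_zpow, ← ofAdd_zsmul]
  change braidTransvection i (m • 1) v = _
  rw [smul_eq_mul, mul_one]

/-- The ping-pong sets of `braidσ n 0 ^ j` and `braidσ n 1 ^ k`, for `4 ≤ |j * k|`. -/
def braidPingPongSet (j : ℤ) (i : Fin 2) : Set (ℕ → ℤ) :=
  ![{v | |j * v 0| < 2 * |v 1|}, {v | 2 * |v 1| < |j * v 0|}] i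

theorem braidTransvection_mem_braidPingPongSet_zero {j m : ℤ} {v : ℕ → ℤ}
    (hm : m ≠ 0) (hv : v ∈ braidPingPongSet j 1) :
    braidTransvection 0 (j * m) v ∈ braidPingPongSet j 0 := by
  change 2 * |v 1| < |j * v 0| at hv
  change |j * v 0| < 2 * |v 1 + j * m * v 0|
  have hmul : |j * v 0| ≤ |j * m * v 0| := by
    rw [mul_right_comm, abs_mul _ m]
    exact le_mul_of_one_le_right (abs_nonneg _) (Int.one_le_abs hm)
  have htri := abs_sub_abs_le_abs_sub (j * m * v 0) (-v 1)
  rw [abs_neg, sub_neg_eq_add, add_comm (j * m * v 0)] at htri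
  linarith

theorem braidTransvection_mem_braidPingPongSet_one {j k m : ℤ} {v : ℕ → ℤ}
    (hjk : 4 ≤ |j * k|) (hm : m ≠ 0) (hv : v ∈ braidPingPongSet j 0) :
    braidTransvection 1 (k * m) v ∈ braidPingPongSet j 1 := by
  change |j * v 0| < 2 * |v 1| at hv
  change 2 * |v 1| < |j * (v 0 - k * m * v 1)|
  have hmul : 4 * |v 1| ≤ |j * (k * m * v 1)| := by
    rw [show j * (k * m * v 1) = j * k * m * v 1 by ring, abs_mul _ (v 1), abs_mul _ m]
    exact mul_le_mul_of_nonneg_right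
      (hjk.trans (le_mul_of_one_le_right (abs_nonneg _) (Int.one_le_abs hm))) (abs_nonneg _)
  have htri := abs_sub_abs_le_abs_sub (j * (k * m * v 1)) (j * v 0)
  rw [← mul_sub, abs_mul j (_ - _), abs_sub_comm, ← abs_mul] at htri
  linarith

theorem lift_braidσ_zpow_injective {n : ℕ} (i₀ i₁ : Fin (n - 1)) (h₀ : (i₀ : ℕ) = 0)
    (h₁ : (i₁ : ℕ) = 1) {j k : ℤ} (hjk : 4 ≤ |j * k|) :
    Function.Injective (FreeGroup.lift ![braidσ n i₀ ^ j, braidσ n i₁ ^ k]) := by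
  let := MulAction.compHom (ℕ → ℤ) (braidTransvectionRep n)
  have hsmul (i : Fin (n - 1)) (p q : ℤ) (v : ℕ → ℤ) :
      (braidσ n i ^ p) ^ q • v = braidTransvection i (p * q) v := by
    rw [← zpow_mul]
    exact braidTransvectionRep_zpow n i (p * q) v
  have hj : j ≠ 0 := by
    rintro rfl
    simp at hjk
  refine FreeGroup.lift_injective_of_zpow_ping_pong _ (braidPingPongSet j) ?_ ?_ ?_
  · rw [Fin.forall_fin_two]
    exact ⟨⟨fun l => l, by simp [braidPingPongSet]⟩,
      ⟨fun l => 1 - l, by simp [braidPingPongSet, hj]⟩⟩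
  · have hdisj : Disjoint (braidPingPongSet j 0) (braidPingPongSet j 1) :=
      Set.disjoint_left.mpr fun v hv => by
        simpa [braidPingPongSet] using le_of_lt (show |j * v 0| < 2 * |v 1| from hv)
    intro i i' hi
    fin_cases i <;> fin_cases i'
    exacts [absurd rfl hi, hdisj, hdisj.symm, absurd rfl hi]
  · intro i i' hi m hm v hv
    fin_cases i <;> fin_cases i'
    · exact absurd rfl hi
    · change (braidσ n i₀ ^ j) ^ m • v ∈ _
      rw [hsmul, h₀]
      exact braidTransvection_mem_braidPingPongSet_zero hm hv
    · change (braidσ n i₁ ^ k) ^ m • v ∈ _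
      rw [hsmul, h₁]
      exact braidTransvection_mem_braidPingPongSet_one hjk hm hv
    · exact absurd rfl hi

end BraidGroup

/-- Two elements freely generate their closure if the induced homomorphism is injective. -/
theorem nonempty_closure_equiv_freeGroup {G : Type*} [Group G] {a b : G}
    (h : Function.Injective (FreeGroup.lift ![a, b])) :
    Nonempty (Subgroup.closure {a, b} ≃* FreeGroup (Fin 2)) := by
  have hrange : (FreeGroup.lift ![a, b]).range = Subgroup.closure {a, b} := by
    rw [FreeGroup.range_lift_eq_closure, Matrix.range_cons_cons_empty]
  exact ⟨((MonoidHom.ofInjective h).trans (MulEquiv.subgroupCongr hrange)).symm⟩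

theorem abs_pair_eq_iff {j k c : ℤ} : ({|j|, |k|} : Set ℤ) = {1, c} ↔
    |j| = 1 ∧ |k| = c ∨ |k| = 1 ∧ |j| = c := by
  rw [Set.pair_eq_pair_iff]
  tauto

theorem four_le_abs_mul {j k : ℤ} (hj : j ≠ 0) (hk : k ≠ 0)
    (h : ∀ c ∈ ({1, 2, 3} : Set ℤ), ¬ (|j| = 1 ∧ |k| = c ∨ |k| = 1 ∧ |j| = c)) :
    4 ≤ |j * k| := by
  have hj' := Int.one_le_abs hj
  have hk' := Int.one_le_abs hk
  have h₁ := h 1 (by simp)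
  have h₂ := h 2 (by simp)
  have h₃ := h 3 (by simp)
  rw [abs_mul]
  generalize |j| = p at *
  generalize |k| = q at *
  by_cases hp : p = 1
  · subst hp; omega
  by_cases hq : q = 1
  · subst hq; omega
  have hp' : 2 ≤ p := by omega
  have hq' : 2 ≤ q := by omega
  nlinarith

/-- For `n ≥ 4` and nonzero integers `j, k`, the subgroup of `B_n`
generated by `σ_1^j` and `σ_2^k` is free of rank 2 iff `{|j|, |k|}` is not one of the
sets `{1}`, `{1,2}`, `{1,3}`. -/
theorem braidGroup_powers_free (n : ℕ) (hn : 4 ≤ n)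
    (j k : ℤ) (hj : j ≠ 0) (hk : k ≠ 0) :
    Nonempty
      ((Subgroup.closure
          ({braidσ n ⟨0, by omega⟩ ^ j, braidσ n ⟨1, by omega⟩ ^ k} :
            Set (BraidGroup n))) ≃* FreeGroup (Fin 2)) ↔
      ¬ (({|j|, |k|} : Set ℤ) = {1} ∨ ({|j|, |k|} : Set ℤ) = {1, 2} ∨
          ({|j|, |k|} : Set ℤ) = {1, 3}) := by
  have hset : (({|j|, |k|} : Set ℤ) = {1}) ↔ (({|j|, |k|} : Set ℤ) = {1, 1}) := by
    rw [Set.pair_eq_singleton]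
  rw [hset, abs_pair_eq_iff, abs_pair_eq_iff, abs_pair_eq_iff]
  refine ⟨fun hfree h => ?_, fun h => ?_⟩
  · have hrel := PresentedGroup.braid_relation (m := n - 1) (i := ⟨0, by omega⟩)
      (j := ⟨1, by omega⟩) rfl
    have hcases : (|j| = 1 ∧ (|k| = 1 ∨ |k| = 2 ∨ |k| = 3)) ∨
        (|k| = 1 ∧ (|j| = 1 ∨ |j| = 2 ∨ |j| = 3)) := by tauto
    rcases hcases with ⟨h1, h2⟩ | ⟨h1, h2⟩
    · exact not_free_of_braid_relation hrel (braid_pow_four_ne_one _ _) h1 h2 hfree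
    · rw [Set.pair_comm] at hfree
      exact not_free_of_braid_relation hrel.symm (braid_pow_four_ne_one _ _) h1 h2 hfree
  · refine nonempty_closure_equiv_freeGroup
      (lift_braidσ_zpow_injective _ _ rfl rfl (four_le_abs_mul hj hk ?_))
    rintro c (rfl | rfl | rfl) <;> tauto
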